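/- Second-order expansion of the reduced cost via Hamiltonian Hessians (Dunn–Bertsekas identity): let f_t : ℝ^n × ℝ^m → ℝ^n and l_t, c_t : ℝ^n × ℝ^m → ℝ be twice continuously differentiable for 1 ≤ t ≤ N, l_{N+1} : ℝ^n → ℝ twice continuously differentiable, and x̂₁ ∈ ℝ^n. Given controls û = (û₁, …, û_N), define the trajectory x̂₁, x̂_{t+1} = f_t(x̂_t, û_t), the co-states λ_{N+1} = ∇ l_{N+1}(x̂_{N+1}), λ_t = ∇_x l_t + ∇_x c_t + (D_x f_t)ᵀ λ_{t+1} (evaluated at (x̂_t, û_t)), the Hamiltonian H_t(x, u) = l_t(x, u) + c_t(x, u) + λ_{t+1}ᵀ f_t(x, u), and its second derivatives P_t = ∇²_{xx} H_t, R_t = ∇²_{uu} H_t, M_t = ∇²_{xu} H_t at (x̂_t, û_t), together with P_{N+1} = ∇² l_{N+1}(x̂_{N+1}). Let J be the reduced cost J(u) = l_{N+1}(x_{N+1}(u)) + ∑_{t=1}^N [l_t(x_t(u), u_t) + c_t(x_t(u), u_t)] with states eliminated through the dynamics. Then for every direction δu = (δu₁, …, δu_N), the second directional derivative (d²/dε²)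 J(û + ε δu) at ε = 0 equals δx_{N+1}ᵀ P_{N+1} δx_{N+1} + ∑_{t=1}^N [δx_tᵀ P_t δx_t + 2 δx_tᵀ M_t δu_t + δu_tᵀ R_t δu_t], where δx₁ = 0 and δx_{t+1} = D_x f_t(x̂_t, û_t) δx_t + D_u f_t(x̂_t, û_t) δu_t. -/

import Mathlib

open scoped RealInnerProductSpace

/-- `ocTraj f x1 u k` is the state `x_{k+1}` of the controlled system
`x₁ = x1`, `x_{t+1} = f_t(x_t, u_t)`. -/
def ocTraj {E U : Type*} (f : ℕ → E × U → E) (x1 : E) (u : ℕ → U) : ℕ → E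
  | 0 => x1
  | (k + 1) => f (k + 1) (ocTraj f x1 u k, u (k + 1))

/-- The reduced cost `J(u) = l_{N+1}(x_{N+1}(u)) + ∑_{t=1}^N [l_t(x_t(u), u_t) + c_t(x_t(u), u_t)]`
with the states eliminated through the dynamics. -/
def redCost {E U : Type*} (f : ℕ → E × U → E) (l c : ℕ → E × U → ℝ)
    (lfin : E → ℝ) (x1 : E) (N : ℕ) (u : ℕ → U) : ℝ :=
  lfin (ocTraj f x1 u N)
    + ∑ t ∈ Finset.Icc 1 N,
        (l t (ocTraj f x1 u (t - 1), u t) + c t (ocTraj f x1 u (t - 1), u t))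

section SecondOrder

variable {E F G : Type*} [NormedAddCommGroup E] [NormedSpace ℝ E]
  [NormedAddCommGroup F] [NormedSpace ℝ F] [NormedAddCommGroup G] [NormedSpace ℝ G]

/-- Second-order chain rule along a curve. -/
theorem iteratedDeriv_two_comp_curve {g : F → G} {γ : ℝ → F} (hg : ContDiff ℝ 2 g)
    (hγ : ContDiff ℝ 2 γ) (s : ℝ) :
    iteratedDeriv 2 (fun ε => g (γ ε)) s
      = iteratedFDeriv ℝ 2 g (γ s) ![deriv γ s, deriv γ s]
        + fderiv ℝ g (γ s) (iteratedDeriv 2 γ s) := by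
  have hγ1 : Differentiable ℝ γ := hγ.differentiable (by norm_num)
  have hg1 : Differentiable ℝ g := hg.differentiable (by norm_num)
  have hγ2 : Differentiable ℝ (deriv γ) :=
    ((contDiff_succ_iff_deriv (n := 1)).1 hγ).2.2.differentiable (by norm_num)
  have hg2 : Differentiable ℝ (fderiv ℝ g) :=
    (hg.fderiv_right (m := 1) (by norm_num)).differentiable (by norm_num)
  have h1 : deriv (fun ε => g (γ ε)) = fun ε => fderiv ℝ g (γ ε) (deriv γ ε) := by
    funext ε
    exact ((hg1 (γ ε)).hasFDerivAt.comp_hasDerivAt ε (hγ1 ε).hasDerivAt).deriv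
  have h2 : HasDerivAt (fun ε => fderiv ℝ g (γ ε)) (fderiv ℝ (fderiv ℝ g) (γ s) (deriv γ s)) s :=
    (hg2 (γ s)).hasFDerivAt.comp_hasDerivAt s (hγ1 s).hasDerivAt
  rw [iteratedDeriv_succ, iteratedDeriv_one, iteratedDeriv_succ, iteratedDeriv_one, h1,
    (h2.clm_apply (hγ2 s).hasDerivAt).deriv, iteratedFDeriv_two_apply]
  simp

/-- The Hessian quadratic form on a product splits into its blocks. -/
theorem iteratedFDeriv_two_prod_apply {g : E × F → G} (hg : ContDiff ℝ 2 g) (z : E × F)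
    (a : E) (b : F) :
    iteratedFDeriv ℝ 2 g z ![(a, b), (a, b)]
      = iteratedFDeriv ℝ 2 g z ![(a, 0), (a, 0)]
        + (2 : ℝ) • iteratedFDeriv ℝ 2 g z ![(a, 0), (0, b)]
        + iteratedFDeriv ℝ 2 g z ![(0, b), (0, b)] := by
  have hs : IsSymmSndFDerivAt ℝ g z := hg.contDiffAt.isSymmSndFDerivAt (by simp)
  have hab : ((a, b) : E × F) = (a, 0) + (0, b) := by simp
  simp only [iteratedFDeriv_two_apply, Matrix.cons_val_zero, Matrix.cons_val_one]
  rw [hab]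
  simp only [map_add, add_apply]
  rw [hs.eq (0, b) (a, 0), two_smul]
  abel

theorem fderiv_comp_prodMk_right_apply {g : E × F → G} (hg : Differentiable ℝ g) (x : E) (u : F)
    (a : E) : fderiv ℝ (fun v => g (v, u)) x a = fderiv ℝ g (x, u) (a, 0) := by
  have h := (hg (x, u)).hasFDerivAt.comp x (hasFDerivAt_prodMk_left (𝕜 := ℝ) x u)
  have h' : fderiv ℝ (fun v => g (v, u)) x = _ := h.fderiv
  simp [h']

theorem fderiv_comp_prodMk_left_apply {g : E × F → G} (hg : Differentiable ℝ g) (x : E) (u : F)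
    (b : F) : fderiv ℝ (fun w => g (x, w)) u b = fderiv ℝ g (x, u) (0, b) := by
  have h := (hg (x, u)).hasFDerivAt.comp u (hasFDerivAt_prodMk_right (𝕜 := ℝ) x u)
  have h' : fderiv ℝ (fun w => g (x, w)) u = _ := h.fderiv
  simp [h']

theorem deriv_add_smul_line (u d : F) (s : ℝ) : deriv (fun ε : ℝ => u + ε • d) s = d := by
  simpa using (((hasDerivAt_id s).smul_const d).const_add u).deriv

theorem deriv_prodMk_curve {α : ℝ → E} {β : ℝ → F} (hα : Differentiable ℝ α)
    (hβ : Differentiable ℝ β) (s : ℝ) :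
    deriv (fun ε => (α ε, β ε)) s = (deriv α s, deriv β s) :=
  ((hα s).hasDerivAt.prodMk (hβ s).hasDerivAt).deriv

theorem iteratedDeriv_two_prodMk_line {α : ℝ → E} (hα : ContDiff ℝ 2 α) (u d : F) (s : ℝ) :
    iteratedDeriv 2 (fun ε : ℝ => (α ε, u + ε • d)) s = (iteratedDeriv 2 α s, 0) := by
  have hα1 : Differentiable ℝ α := hα.differentiable (by norm_num)
  have hα2 : Differentiable ℝ (deriv α) :=
    ((contDiff_succ_iff_deriv (n := 1)).1 hα).2.2.differentiable (by norm_num)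
  have h1 : deriv (fun ε : ℝ => (α ε, u + ε • d)) = fun ε => (deriv α ε, d) := by
    funext ε
    rw [deriv_prodMk_curve hα1 (by fun_prop), deriv_add_smul_line]
  rw [iteratedDeriv_succ, iteratedDeriv_one, iteratedDeriv_succ, iteratedDeriv_one, h1,
    deriv_prodMk_curve hα2 (by fun_prop), deriv_const]

theorem contDiff_ocTraj {f : ℕ → E × F → E} (hf : ∀ t, ContDiff ℝ 2 (f t)) (x1 : E)
    (u d : ℕ → F) (k : ℕ) :
    ContDiff ℝ 2 (fun ε : ℝ => ocTraj f x1 (fun t => u t + ε • d t) k) := by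
  induction k with
  | zero => exact contDiff_const
  | succ k ih =>
    exact (hf (k + 1)).comp (ih.prodMk (contDiff_const.add (contDiff_id.smul contDiff_const)))

/-- The first-order variation of the trajectory obeys the linearized dynamics. -/
theorem deriv_ocTraj_succ {f : ℕ → E × F → E} (hf : ∀ t, ContDiff ℝ 2 (f t)) (x1 : E)
    (u d : ℕ → F) (k : ℕ) :
    deriv (fun ε : ℝ => ocTraj f x1 (fun t => u t + ε • d t) (k + 1)) 0
      = fderiv ℝ (fun v => f (k + 1) (v, u (k + 1))) (ocTraj f x1 u k)
          (deriv (fun ε : ℝ => ocTraj f x1 (fun t => u t + ε • d t) k) 0)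
        + fderiv ℝ (fun w => f (k + 1) (ocTraj f x1 u k, w)) (u (k + 1)) (d (k + 1)) := by
  have hfd : Differentiable ℝ (f (k + 1)) := (hf (k + 1)).differentiable (by norm_num)
  have hX : Differentiable ℝ (fun ε : ℝ => ocTraj f x1 (fun t => u t + ε • d t) k) :=
    (contDiff_ocTraj hf x1 u d k).differentiable (by norm_num)
  have hγ : HasDerivAt (fun ε : ℝ => (ocTraj f x1 (fun t => u t + ε • d t) k,
      u (k + 1) + ε • d (k + 1))) _ 0 :=
    DifferentiableAt.hasDerivAt (by fun_prop)
  rw [deriv_prodMk_curve hX (by fun_prop), deriv_add_smul_line] at hγ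
  have h := (hfd _).hasFDerivAt.comp_hasDerivAt 0 hγ
  refine h.deriv.trans ?_
  rw [fderiv_comp_prodMk_right_apply hfd, fderiv_comp_prodMk_left_apply hfd, ← map_add]
  simp

end SecondOrder

theorem sum_Icc_one_sub_telescope {G : Type*} [AddCommGroup G] (a : ℕ → G) (N : ℕ) :
    ∑ t ∈ Finset.Icc 1 N, (a (t - 1) - a t) = a 0 - a N := by
  induction N with
  | zero => simp
  | succ N ih =>
    rw [Finset.sum_Icc_succ_top (by omega), ih]
    simp

/-- Second-order expansion of the reduced cost via Hamiltonian Hessians (Dunn–Bertsekas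
identity): along the nominal trajectory `x̂` of `û` with co-states `λ` and Hamiltonians
`H_t(x, u) = l_t(x, u) + c_t(x, u) + λ_{t+1}ᵀ f_t(x, u)`, for every direction `δu` the second
directional derivative of the reduced cost `J` at `û` equals
`δx_{N+1}ᵀ P_{N+1} δx_{N+1} + ∑_{t=1}^N [δx_tᵀ P_t δx_t + 2 δx_tᵀ M_t δu_t + δu_tᵀ R_t δu_t]`,
where `P_t, M_t, R_t` are the blockwise second derivatives of `H_t`, `P_{N+1} = ∇²l_{N+1}`,
`δx₁ = 0` and `δx_{t+1} = Dₓf_t δx_t + Dᵤf_t δu_t`. -/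
theorem reduced_cost_second_directional_derivative (n m N : ℕ) (hN : 1 ≤ N)
    (f : ℕ → EuclideanSpace ℝ (Fin n) × EuclideanSpace ℝ (Fin m) → EuclideanSpace ℝ (Fin n))
    (l c : ℕ → EuclideanSpace ℝ (Fin n) × EuclideanSpace ℝ (Fin m) → ℝ)
    (lfin : EuclideanSpace ℝ (Fin n) → ℝ)
    (hf : ∀ t, ContDiff ℝ 2 (f t)) (hl : ∀ t, ContDiff ℝ 2 (l t))
    (hc : ∀ t, ContDiff ℝ 2 (c t)) (hlfin : ContDiff ℝ 2 lfin)
    (x1 : EuclideanSpace ℝ (Fin n)) (uh : ℕ → EuclideanSpace ℝ (Fin m))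
    -- the nominal state trajectory: `x̂_t = xh t`
    (xh : ℕ → EuclideanSpace ℝ (Fin n))
    (hxh : ∀ t, 1 ≤ t → xh t = ocTraj f x1 uh (t - 1))
    -- the co-states along the nominal trajectory
    (lam : ℕ → EuclideanSpace ℝ (Fin n))
    (hlamN : lam (N + 1) = gradient lfin (xh (N + 1)))
    (hlam : ∀ t, 1 ≤ t → t ≤ N →
        lam t = gradient (fun v => l t (v, uh t)) (xh t)
          + gradient (fun v => c t (v, uh t)) (xh t)
          + ContinuousLinearMap.adjoint
              (fderiv ℝ (fun v => f t (v, uh t)) (xh t)) (lam (t + 1)))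
    -- the Hamiltonians
    (H : ℕ → EuclideanSpace ℝ (Fin n) × EuclideanSpace ℝ (Fin m) → ℝ)
    (hH : ∀ t z, H t z = l t z + c t z + ⟪lam (t + 1), f t z⟫)
    -- the direction `δu` and the linearized state deviations `δx`
    (du : ℕ → EuclideanSpace ℝ (Fin m))
    (dx : ℕ → EuclideanSpace ℝ (Fin n))
    (hdx1 : dx 1 = 0)
    (hdx : ∀ t, 1 ≤ t → t ≤ N →
        dx (t + 1) = fderiv ℝ (fun v => f t (v, uh t)) (xh t) (dx t)
          + fderiv ℝ (fun w => f t (xh t, w)) (uh t) (du t)) :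
    iteratedDeriv 2
        (fun ε : ℝ => redCost f l c lfin x1 N (fun t => uh t + ε • du t)) 0
      = iteratedFDeriv ℝ 2 lfin (xh (N + 1)) ![dx (N + 1), dx (N + 1)]
        + ∑ t ∈ Finset.Icc 1 N,
            (iteratedFDeriv ℝ 2 (H t) (xh t, uh t) ![(dx t, 0), (dx t, 0)]
              + 2 * iteratedFDeriv ℝ 2 (H t) (xh t, uh t) ![(dx t, 0), (0, du t)]
              + iteratedFDeriv ℝ 2 (H t) (xh t, uh t) ![(0, du t), (0, du t)]) := by
  set X : ℕ → ℝ → EuclideanSpace ℝ (Fin n) :=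
    fun k ε => ocTraj f x1 (fun t => uh t + ε • du t) k with hXdef
  have hX : ∀ k, ContDiff ℝ 2 (X k) := contDiff_ocTraj hf x1 uh du
  have hX0 : ∀ k, X k 0 = xh (k + 1) := fun k => by simp [hXdef, hxh (k + 1) (by omega)]
  have hXd : ∀ k, k ≤ N → deriv (X k) 0 = dx (k + 1) := by
    intro k
    induction k with
    | zero => intro _; rw [hdx1]; exact deriv_const _ _
    | succ k ih =>
      intro hk
      rw [hdx (k + 1) (by omega) hk, ← ih (by omega), hxh (k + 1) (by omega)]
      exact deriv_ocTraj_succ hf x1 uh du k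
  have hHc : ∀ t, ContDiff ℝ 2 (H t) := fun t => by
    rw [show H t = fun z => l t z + c t z + ⟪lam (t + 1), f t z⟫ from funext (hH t)]
    exact ((hl t).add (hc t)).add (contDiff_const.inner ℝ (hf t))
  have hγ : ∀ t, ContDiff ℝ 2 (fun ε : ℝ => (X (t - 1) ε, uh t + ε • du t)) := fun t =>
    (hX (t - 1)).prodMk (contDiff_const.add (contDiff_id.smul contDiff_const))
  have hinner : ∀ t, iteratedDeriv 2 (fun ε => ⟪lam (t + 1), X t ε⟫) 0
      = ⟪lam (t + 1), iteratedDeriv 2 (X t) 0⟫ := fun t => by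
    have h := iteratedDeriv_two_comp_curve (innerSL ℝ (lam (t + 1))).contDiff (hX t) 0
    have hL : fderiv ℝ (innerSL ℝ (lam (t + 1))) = fun _ => innerSL ℝ (lam (t + 1)) :=
      funext fun _ => (innerSL ℝ (lam (t + 1))).fderiv
    rw [iteratedFDeriv_two_apply, hL, fderiv_const_apply, zero_apply, zero_apply, zero_add] at h
    exact h
  -- the co-state recursion: the state gradient of the Hamiltonian is the co-state
  have hcostate : ∀ t, 1 ≤ t → t ≤ N → ∀ a, fderiv ℝ (H t) (xh t, uh t) (a, 0) = ⟪lam t, a⟫ := by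
    intro t ht htN a
    have dl := (hl t).differentiable (by norm_num)
    have dc := (hc t).differentiable (by norm_num)
    have df := (hf t).differentiable (by norm_num)
    have hfd : HasFDerivAt (H t) (fderiv ℝ (l t) (xh t, uh t) + fderiv ℝ (c t) (xh t, uh t)
        + (innerSL ℝ (lam (t + 1))).comp (fderiv ℝ (f t) (xh t, uh t))) (xh t, uh t) := by
      rw [show H t = fun z => l t z + c t z + ⟪lam (t + 1), f t z⟫ from funext (hH t)]
      exact ((dl _).hasFDerivAt.add (dc _).hasFDerivAt).add
        ((innerSL ℝ (lam (t + 1))).hasFDerivAt.comp _ (df _).hasFDerivAt)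
    rw [hfd.fderiv, hlam t ht htN, inner_add_left, inner_add_left,
      ContinuousLinearMap.adjoint_inner_left, ← InnerProductSpace.toDual_apply_apply (𝕜 := ℝ),
      toDual_gradient, ← InnerProductSpace.toDual_apply_apply (𝕜 := ℝ) (x := gradient _ _),
      toDual_gradient, fderiv_comp_prodMk_right_apply dl, fderiv_comp_prodMk_right_apply dc,
      fderiv_comp_prodMk_right_apply df]
    simp
  have hterm : ∀ t ∈ Finset.Icc 1 N,
      iteratedDeriv 2 (fun ε : ℝ => H t (X (t - 1) ε, uh t + ε • du t) - ⟪lam (t + 1), X t ε⟫) 0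
      = (iteratedFDeriv ℝ 2 (H t) (xh t, uh t) ![(dx t, 0), (dx t, 0)]
          + 2 * iteratedFDeriv ℝ 2 (H t) (xh t, uh t) ![(dx t, 0), (0, du t)]
          + iteratedFDeriv ℝ 2 (H t) (xh t, uh t) ![(0, du t), (0, du t)])
        + (⟪lam (t - 1 + 1), iteratedDeriv 2 (X (t - 1)) 0⟫
          - ⟪lam (t + 1), iteratedDeriv 2 (X t) 0⟫) := by
    intro t ht
    obtain ⟨ht1, htN⟩ := Finset.mem_Icc.1 ht
    have e : t - 1 + 1 = t := by omega
    have hHγ : ContDiff ℝ 2 (fun ε : ℝ => H t (X (t - 1) ε, uh t + ε • du t)) :=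
      (hHc t).comp (hγ t)
    rw [iteratedDeriv_fun_sub hHγ.contDiffAt (contDiff_const.inner ℝ (hX t)).contDiffAt, hinner,
      iteratedDeriv_two_comp_curve (hHc t) (hγ t), iteratedDeriv_two_prodMk_line (hX (t - 1)),
      deriv_prodMk_curve ((hX (t - 1)).differentiable (by norm_num)) (by fun_prop),
      deriv_add_smul_line, hXd (t - 1) (by omega), hX0, e, zero_smul, add_zero,
      hcostate t ht1 htN, iteratedFDeriv_two_prod_apply (hHc t), smul_eq_mul]
    ring
  have hJ : (fun ε : ℝ => redCost f l c lfin x1 N (fun t => uh t + ε • du t))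
      = fun ε => lfin (X N ε) + ∑ t ∈ Finset.Icc 1 N,
          (H t (X (t - 1) ε, uh t + ε • du t) - ⟪lam (t + 1), X t ε⟫) := by
    funext ε
    refine congrArg (lfin (X N ε) + ·) (Finset.sum_congr rfl fun t ht => ?_)
    obtain ⟨k, rfl⟩ : ∃ k, t = k + 1 := ⟨t - 1, by have := (Finset.mem_Icc.1 ht).1; omega⟩
    simp [hH, hXdef, ocTraj]
  have hsm : ∀ t, ContDiff ℝ 2
      (fun ε : ℝ => H t (X (t - 1) ε, uh t + ε • du t) - ⟪lam (t + 1), X t ε⟫) := fun t =>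
    ((hHc t).comp (hγ t)).sub (contDiff_const.inner ℝ (hX t))
  have hX00 : iteratedDeriv 2 (X 0) 0 = 0 := by
    rw [show X 0 = fun _ => x1 from rfl]
    simp [iteratedDeriv_const]
  have hlX : ContDiff ℝ 2 (fun ε => lfin (X N ε)) := hlfin.comp (hX N)
  rw [hJ, iteratedDeriv_fun_add hlX.contDiffAt (ContDiff.sum fun t _ => hsm t).contDiffAt, iteratedDeriv_fun_sum fun t _ => (hsm t).contDiffAt,
    Finset.sum_congr rfl hterm, Finset.sum_add_distrib,
    sum_Icc_one_sub_telescope (fun k => ⟪lam (k + 1), iteratedDeriv 2 (X k) 0⟫),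
    iteratedDeriv_two_comp_curve hlfin (hX N), hXd N le_rfl, hX0, hlamN, hX00, inner_zero_right,
    ← toDual_gradient, InnerProductSpace.toDual_apply_apply]
  ring
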